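/- Fix N ≥ 1 and k ≥ 0. For every 1 ≤ l ≤ N one has the (not necessarily orthogonal) direct sum decomposition V^k_{l,N,D} = V^k_{l−1,N,D} ⊕ W^k_{l,N,D}, i.e., V^k_{l−1,N,D} ∩ W^k_{l,N,D} = {0} and V^k_{l−1,N,D} + W^k_{l,N,D} = V^k_{l,N,D}. Consequently V^k_{N,D} := V^k_{N,N,D} = ⊕_{l=0}^{N} W^k_{l,N,D}. -/

import Mathlib

open scoped BigOperators
open MeasureTheory

def PPoly (a b : ℝ) (n k : ℕ) (f : ℝ → ℝ) : Prop :=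
  (∀ j : ℕ, j < 2 ^ n →
    ∃ p : Polynomial ℝ, p.natDegree ≤ k ∧
      ∀ x ∈ Set.Ico (a + j * ((b - a) / 2 ^ n)) (a + (j + 1) * ((b - a) / 2 ^ n)),
        f x = p.eval x) ∧
  ∀ x, x ∉ Set.Ico a b → f x = 0

noncomputable def Vsp (a b : ℝ) (n k : ℕ) : Submodule ℝ (ℝ → ℝ) :=
  Submodule.span ℝ {f | PPoly a b n k f}

noncomputable def L2ip (a b : ℝ) (f g : ℝ → ℝ) : ℝ := ∫ x in Set.Ico a b, f x * g x

noncomputable def Wsp (a b : ℝ) (n k : ℕ) : Submodule ℝ (ℝ → ℝ) :=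
  if n = 0 then Vsp a b 0 k
  else Submodule.span ℝ
    {f | f ∈ Vsp a b n k ∧ ∀ g ∈ Vsp a b (n - 1) k, L2ip a b f g = 0}

noncomputable def dualLeft (N l j : ℕ) : ℝ :=
  if j = 0 then 0 else (j : ℝ) / 2 ^ l - 1 / 2 ^ (N + 1)

noncomputable def dualRight (N l j : ℕ) : ℝ :=
  if j = 2 ^ l then 1 else ((j : ℝ) + 1) / 2 ^ l - 1 / 2 ^ (N + 1)

def dualPPoly (N l k : ℕ) (f : ℝ → ℝ) : Prop :=
  (∀ j : ℕ, j ≤ 2 ^ l →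
    ∃ p : Polynomial ℝ, p.natDegree ≤ k ∧
      ∀ x ∈ Set.Ico (dualLeft N l j) (dualRight N l j), f x = p.eval x) ∧
  ∀ x, x ∉ Set.Ico (0 : ℝ) 1 → f x = 0

noncomputable def Vd (N l k : ℕ) : Submodule ℝ (ℝ → ℝ) :=
  Submodule.span ℝ {f | dualPPoly N l k f}

/-- The restriction map to `[0,1]` (functions are extended by zero outside `[0,1)`). -/
noncomputable def restr01 : (ℝ → ℝ) →ₗ[ℝ] (ℝ → ℝ) where
  toFun f := (Set.Ico (0 : ℝ) 1).indicator f
  map_add' f g := by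
    funext x
    by_cases h : x ∈ Set.Ico (0 : ℝ) 1 <;> simp [Set.indicator, h]
  map_smul' c f := by
    funext x
    by_cases h : x ∈ Set.Ico (0 : ℝ) 1 <;> simp [Set.indicator, h]

/-- The dual increment space `W^k_{l,N,D}`: `V^k_{0,N,D}` for `l = 0`, and the restriction to
`[0,1]` of the multiwavelet space `W_l^k([-h_N/2, 1-h_N/2])` for `l ≥ 1`. -/
noncomputable def Wd (N l k : ℕ) : Submodule ℝ (ℝ → ℝ) :=
  if l = 0 then Vd N 0 k
  else Submodule.map restr01 (Wsp (-(1 / 2 ^ (N + 1))) (1 - 1 / 2 ^ (N + 1)) l k)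

open Polynomial in
theorem mem_degreeLT_succ_iff_natDegree_le (p : ℝ[X]) (k : ℕ) :
    p ∈ degreeLT ℝ (k + 1) ↔ p.natDegree ≤ k := by
  rw [mem_degreeLT, degree_lt_iff_coeff_zero, natDegree_le_iff_coeff_eq_zero]
  exact forall_congr' fun m => by rw [Nat.succ_le_iff]

theorem Polynomial.integrableOn_Ico (p : Polynomial ℝ) (c d : ℝ) :
    IntegrableOn (fun x => p.eval x) (Set.Ico c d) :=
  (p.continuous.integrableOn_Icc).mono_set Set.Ico_subset_Icc_self

theorem Polynomial.integrableOn_mul_Ico (p q : Polynomial ℝ) (c d : ℝ) :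
    IntegrableOn (fun x => p.eval x * q.eval x) (Set.Ico c d) := by
  simpa using (p * q).integrableOn_Ico c d

theorem Polynomial.eq_zero_of_eval_Ico {c d : ℝ} (hcd : c < d) {p : Polynomial ℝ}
    (h : ∀ x ∈ Set.Ico c d, p.eval x = 0) : p = 0 :=
  p.eq_zero_of_infinite_isRoot ((Set.Ico_infinite hcd).mono h)

theorem Polynomial.eq_zero_of_integral_mul_self {c d : ℝ} (hcd : c < d) {p : Polynomial ℝ}
    (h : ∫ x in Set.Ico c d, p.eval x * p.eval x = 0) : p = 0 := by
  by_contra hp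
  obtain ⟨x, hx, hx0⟩ : ∃ x ∈ Set.Ico c d, p.eval x ≠ 0 := by
    by_contra! hall
    exact hp (eq_zero_of_eval_Ico hcd hall)
  have hpos : 0 < ∫ x in c..d, p.eval x * p.eval x :=
    intervalIntegral.integral_pos hcd (p.continuous.mul p.continuous).continuousOn
      (fun y _ => mul_self_nonneg _) ⟨x, Set.Ico_subset_Icc_self hx, mul_self_pos.2 hx0⟩
  rw [intervalIntegral.integral_of_le hcd.le, ← integral_Ico_eq_integral_Ioc, h] at hpos
  exact lt_irrefl _ hpos

/-- The form `(p, q) ↦ ∫ x in [c, d), p x * q x` on polynomials of degree less than `m`. -/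
noncomputable def polyL2Form (c d : ℝ) (m : ℕ) :
    Polynomial.degreeLT ℝ m →ₗ[ℝ] Module.Dual ℝ (Polynomial.degreeLT ℝ m) :=
  LinearMap.mk₂ ℝ (fun p q => ∫ x in Set.Ico c d, p.1.eval x * q.1.eval x)
    (fun p p' q => by
      rw [← integral_add]
      · simp [add_mul]
      · exact p.1.integrableOn_mul_Ico q.1 c d
      · exact p'.1.integrableOn_mul_Ico q.1 c d)
    (fun r p q => by simp [mul_assoc, integral_const_mul])
    (fun p q q' => by
      rw [← integral_add]
      · simp [mul_add]
      · exact p.1.integrableOn_mul_Ico q.1 c d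
      · exact p.1.integrableOn_mul_Ico q'.1 c d)
    (fun r p q => by simp [mul_left_comm, integral_const_mul])

/-- Existence of the `L²([c, d))`-projection onto polynomials of degree at most `k`. -/
theorem exists_polynomial_projection {c d : ℝ} (hcd : c < d) (k : ℕ) (f : ℝ → ℝ)
    (hf : ∀ q : Polynomial ℝ, IntegrableOn (fun x => f x * q.eval x) (Set.Ico c d)) :
    ∃ p : Polynomial ℝ, p.natDegree ≤ k ∧ ∀ q : Polynomial ℝ, q.natDegree ≤ k →
      ∫ x in Set.Ico c d, (f x - p.eval x) * q.eval x = 0 := by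
  have : Module.Finite ℝ (Polynomial.degreeLT ℝ (k + 1)) :=
    Module.Finite.equiv (Polynomial.degreeLTEquiv ℝ (k + 1)).symm
  have hinj : Function.Injective (polyL2Form c d (k + 1)) := by
    rw [injective_iff_map_eq_zero]
    intro p hp
    exact Subtype.ext (Polynomial.eq_zero_of_integral_mul_self hcd (LinearMap.congr_fun hp p))
  have hsurj := (LinearMap.injective_iff_surjective_of_finrank_eq_finrank
    (Subspace.dual_finrank_eq (K := ℝ) (V := Polynomial.degreeLT ℝ (k + 1))).symm).1 hinj
  let φ : Module.Dual ℝ (Polynomial.degreeLT ℝ (k + 1)) :=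
    { toFun := fun q => ∫ x in Set.Ico c d, f x * q.1.eval x
      map_add' := fun q q' => by
        rw [← integral_add (hf q.1) (hf q'.1)]
        simp [mul_add]
      map_smul' := fun r q => by simp [mul_left_comm, integral_const_mul] }
  obtain ⟨p, hp⟩ := hsurj φ
  refine ⟨p.1, (mem_degreeLT_succ_iff_natDegree_le _ _).1 p.2, fun q hq => ?_⟩
  have hpq : ∫ x in Set.Ico c d, p.1.eval x * q.eval x = ∫ x in Set.Ico c d, f x * q.eval x :=
    LinearMap.congr_fun hp ⟨q, (mem_degreeLT_succ_iff_natDegree_le _ _).2 hq⟩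
  simp_rw [sub_mul]
  rw [integral_sub (hf q) (p.1.integrableOn_mul_Ico q c d), hpq, sub_self]

theorem mem_span_piecewise_polynomial_iff (J : ℕ → Prop) (S : ℕ → Set ℝ) (T : Set ℝ) (k : ℕ)
    (f : ℝ → ℝ) :
    f ∈ Submodule.span ℝ {f : ℝ → ℝ | (∀ j, J j → ∃ p : Polynomial ℝ, p.natDegree ≤ k ∧
        ∀ x ∈ S j, f x = p.eval x) ∧ ∀ x, x ∉ T → f x = 0} ↔
      (∀ j, J j → ∃ p : Polynomial ℝ, p.natDegree ≤ k ∧ ∀ x ∈ S j, f x = p.eval x) ∧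
        ∀ x, x ∉ T → f x = 0 := by
  refine ⟨fun hf => ?_, fun hf => Submodule.subset_span hf⟩
  induction hf using Submodule.span_induction with
  | mem f hf => exact hf
  | zero => exact ⟨fun j _ => ⟨0, by simp⟩, by simp⟩
  | add f g _ _ hf hg =>
    refine ⟨fun j hj => ?_, fun x hx => by simp [hf.2 x hx, hg.2 x hx]⟩
    obtain ⟨p, hp, hfp⟩ := hf.1 j hj
    obtain ⟨q, hq, hgq⟩ := hg.1 j hj
    exact ⟨p + q, Polynomial.natDegree_add_le_of_degree_le hp hq,
      fun x hx => by simp [hfp x hx, hgq x hx]⟩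
  | smul c f _ hf =>
    refine ⟨fun j hj => ?_, fun x hx => by simp [hf.2 x hx]⟩
    obtain ⟨p, hp, hfp⟩ := hf.1 j hj
    exact ⟨c • p, (Polynomial.natDegree_smul_le c p).trans hp, fun x hx => by simp [hfp x hx]⟩

/-- The `j`-th cell of the uniform partition of `[a, b)` into `2 ^ n` cells. -/
def cell (a b : ℝ) (n j : ℕ) : Set ℝ :=
  Set.Ico (a + j * ((b - a) / 2 ^ n)) (a + (j + 1) * ((b - a) / 2 ^ n))

theorem measurableSet_cell (a b : ℝ) (n j : ℕ) : MeasurableSet (cell a b n j) :=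
  measurableSet_Ico

theorem mem_Vsp_iff {a b : ℝ} {n k : ℕ} {f : ℝ → ℝ} : f ∈ Vsp a b n k ↔ PPoly a b n k f :=
  mem_span_piecewise_polynomial_iff (· < 2 ^ n) (cell a b n) (Set.Ico a b) k f

theorem mem_Vd_iff {N l k : ℕ} {f : ℝ → ℝ} : f ∈ Vd N l k ↔ dualPPoly N l k f :=
  mem_span_piecewise_polynomial_iff (· ≤ 2 ^ l)
    (fun j => Set.Ico (dualLeft N l j) (dualRight N l j)) (Set.Ico 0 1) k f

theorem left_lt_right_cell {a b : ℝ} (hab : a < b) (n j : ℕ) :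
    a + j * ((b - a) / 2 ^ n) < a + (j + 1) * ((b - a) / 2 ^ n) := by
  have : 0 < (b - a) / 2 ^ n := div_pos (sub_pos.2 hab) (by positivity)
  linarith

theorem cell_subset_Ico {a b : ℝ} (hab : a < b) {n j : ℕ} (hj : j < 2 ^ n) :
    cell a b n j ⊆ Set.Ico a b := by
  have hh : 0 < (b - a) / 2 ^ n := div_pos (sub_pos.2 hab) (by positivity)
  have hj' : (j : ℝ) + 1 ≤ 2 ^ n := by exact_mod_cast hj
  apply Set.Ico_subset_Ico
  · have : 0 ≤ (j : ℝ) * ((b - a) / 2 ^ n) := by positivity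
    linarith
  · calc a + (j + 1) * ((b - a) / 2 ^ n) ≤ a + 2 ^ n * ((b - a) / 2 ^ n) := by gcongr
      _ = b := by field_simp; ring

theorem floor_eq_of_mem_cell {a b : ℝ} (hab : a < b) {n j : ℕ} {x : ℝ}
    (hx : x ∈ cell a b n j) : ⌊(x - a) / ((b - a) / 2 ^ n)⌋₊ = j := by
  have hh : 0 < (b - a) / 2 ^ n := div_pos (sub_pos.2 hab) (by positivity)
  have h0 : 0 ≤ (j : ℝ) * ((b - a) / 2 ^ n) := by positivity
  have hx1 := hx.1
  have hx2 := hx.2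
  rw [Nat.floor_eq_iff (div_nonneg (by linarith) hh.le), le_div_iff₀ hh, div_lt_iff₀ hh]
  constructor <;> linarith

theorem exists_mem_cell {a b : ℝ} (n : ℕ) {x : ℝ} (hx : x ∈ Set.Ico a b) :
    ∃ j < 2 ^ n, x ∈ cell a b n j := by
  have hab : a < b := hx.1.trans_lt hx.2
  have hh : 0 < (b - a) / 2 ^ n := div_pos (sub_pos.2 hab) (by positivity)
  have h0 : 0 ≤ (x - a) / ((b - a) / 2 ^ n) := div_nonneg (by linarith [hx.1]) hh.le
  obtain ⟨h1, h2⟩ := (Nat.floor_eq_iff h0).1 rfl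
  rw [le_div_iff₀ hh] at h1
  rw [div_lt_iff₀ hh] at h2
  refine ⟨⌊(x - a) / ((b - a) / 2 ^ n)⌋₊, ?_, ?_, ?_⟩
  · rw [Nat.floor_lt h0, div_lt_iff₀ hh]
    push_cast
    rw [mul_div_cancel₀ _ (by positivity)]
    linarith [hx.2]
  · linarith
  · linarith

theorem cell_eq_union {a b : ℝ} (hab : a < b) (n j : ℕ) :
    cell a b n j = cell a b (n + 1) (2 * j) ∪ cell a b (n + 1) (2 * j + 1) := by
  have hh : 0 < (b - a) / 2 ^ n := div_pos (sub_pos.2 hab) (by positivity)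
  have hh' : (b - a) / 2 ^ (n + 1) = (b - a) / 2 ^ n / 2 := by rw [pow_succ]; field_simp
  unfold cell
  rw [hh']
  push_cast
  rw [Set.Ico_union_Ico_eq_Ico]
  · congr 1 <;> ring
  · linarith
  · linarith

/-- The function on `[a, b)` given on the `j`-th cell by the polynomial `p j`. -/
noncomputable def gluePoly (a b : ℝ) (n : ℕ) (p : ℕ → Polynomial ℝ) : ℝ → ℝ :=
  (Set.Ico a b).indicator fun x => (p ⌊(x - a) / ((b - a) / 2 ^ n)⌋₊).eval x

theorem gluePoly_apply {a b : ℝ} (hab : a < b) {n j : ℕ} (hj : j < 2 ^ n)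
    (p : ℕ → Polynomial ℝ) {x : ℝ} (hx : x ∈ cell a b n j) :
    gluePoly a b n p x = (p j).eval x := by
  rw [gluePoly, Set.indicator_of_mem (cell_subset_Ico hab hj hx), floor_eq_of_mem_cell hab hx]

theorem gluePoly_mem_Vsp {a b : ℝ} (hab : a < b) {n k : ℕ} {p : ℕ → Polynomial ℝ}
    (hp : ∀ j < 2 ^ n, (p j).natDegree ≤ k) : gluePoly a b n p ∈ Vsp a b n k :=
  mem_Vsp_iff.2 ⟨fun j hj => ⟨p j, hp j hj, fun _ hx => gluePoly_apply hab hj p hx⟩,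
    fun _ hx => Set.indicator_of_notMem hx _⟩

theorem Vsp_le_succ {a b : ℝ} (hab : a < b) (n k : ℕ) : Vsp a b n k ≤ Vsp a b (n + 1) k := by
  intro f hf
  obtain ⟨hf, hf'⟩ := mem_Vsp_iff.1 hf
  refine mem_Vsp_iff.2 ⟨fun j hj => ?_, hf'⟩
  obtain ⟨p, hp, hfp⟩ := hf (j / 2) (by rw [pow_succ] at hj; omega)
  refine ⟨p, hp, fun x hx => hfp x ?_⟩
  change x ∈ cell a b n (j / 2)
  rw [cell_eq_union hab]
  rcases Nat.even_or_odd' j with ⟨m, rfl | rfl⟩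
  · left
    rwa [show 2 * m / 2 = m by omega]
  · right
    rwa [show (2 * m + 1) / 2 = m by omega]

theorem integrableOn_mul_eval_cell {a b : ℝ} {n k : ℕ} {f : ℝ → ℝ} (hf : f ∈ Vsp a b n k)
    {j : ℕ} (hj : j < 2 ^ n) (q : Polynomial ℝ) :
    IntegrableOn (fun x => f x * q.eval x) (cell a b n j) := by
  obtain ⟨p, -, hfp⟩ := (mem_Vsp_iff.1 hf).1 j hj
  exact (p.integrableOn_mul_Ico q _ _).congr_fun (fun x hx => by simp only [hfp x hx])
    measurableSet_Ico

theorem integrableOn_mul_eval_coarse_cell {a b : ℝ} (hab : a < b) {n k : ℕ} {f : ℝ → ℝ}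
    (hf : f ∈ Vsp a b (n + 1) k) {j : ℕ} (hj : j < 2 ^ n) (q : Polynomial ℝ) :
    IntegrableOn (fun x => f x * q.eval x) (cell a b n j) := by
  rw [cell_eq_union hab]
  rw [← Nat.mul_lt_mul_left two_pos, ← pow_succ'] at hj
  exact (integrableOn_mul_eval_cell hf hj q).union (integrableOn_mul_eval_cell hf (by
    rw [pow_succ] at *; omega) q)

theorem setIntegral_Ico_eq_zero_of_cells {a b : ℝ} (hab : a < b) (n : ℕ) {f : ℝ → ℝ}
    (h : ∀ j < 2 ^ n, ∫ x in cell a b n j, f x = 0) : ∫ x in Set.Ico a b, f x = 0 := by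
  by_cases hf : IntegrableOn f (Set.Ico a b)
  swap
  · exact integral_undef hf
  have hh : 0 < (b - a) / 2 ^ n := div_pos (sub_pos.2 hab) (by positivity)
  have hpart : ∀ m : ℕ, m ≤ 2 ^ n → IntegrableOn f (Set.Ico a (a + m * ((b - a) / 2 ^ n))) ∧
      ∫ x in Set.Ico a (a + m * ((b - a) / 2 ^ n)), f x = 0 := by
    intro m hm
    induction m with
    | zero => simp
    | succ m ih =>
      obtain ⟨hi, h0⟩ := ih (by omega)
      have hc : IntegrableOn f (cell a b n m) := hf.mono_set (cell_subset_Ico hab hm)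
      have hu : Set.Ico a (a + (m + 1 : ℕ) * ((b - a) / 2 ^ n)) =
          Set.Ico a (a + m * ((b - a) / 2 ^ n)) ∪ cell a b n m := by
        have : 0 ≤ (m : ℝ) * ((b - a) / 2 ^ n) := by positivity
        rw [cell, Set.Ico_union_Ico_eq_Ico (by linarith) (left_lt_right_cell hab n m).le]
        push_cast
        rfl
      rw [hu]
      refine ⟨hi.union hc, ?_⟩
      rw [setIntegral_union _ (measurableSet_cell a b n m) hi hc, h0, h m hm, add_zero]
      exact Set.disjoint_left.2 fun x hx hx' => not_lt.2 hx'.1 hx.2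
  have := (hpart (2 ^ n) le_rfl).2
  push_cast at this
  rwa [mul_div_cancel₀ _ (by positivity), add_sub_cancel] at this

theorem Wsp_le {a b : ℝ} (n k : ℕ) : Wsp a b n k ≤ Vsp a b n k := by
  unfold Wsp
  split_ifs with h
  · rw [h]
  · exact Submodule.span_le.2 fun f hf => hf.1

theorem integral_cell_eq_zero_of_mem_Wsp {a b : ℝ} (hab : a < b) {n k : ℕ} {f : ℝ → ℝ}
    (hf : f ∈ Wsp a b (n + 1) k) {j : ℕ} (hj : j < 2 ^ n) {q : Polynomial ℝ}
    (hq : q.natDegree ≤ k) : ∫ x in cell a b n j, f x * q.eval x = 0 := by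
  rw [Wsp, if_neg n.succ_ne_zero, Nat.add_sub_cancel] at hf
  have key : f ∈ Vsp a b (n + 1) k ∧ ∫ x in cell a b n j, f x * q.eval x = 0 := by
    induction hf using Submodule.span_induction with
    | mem f hf =>
      refine ⟨hf.1, ?_⟩
      have hg : (cell a b n j).indicator (fun x => q.eval x) ∈ Vsp a b n k := by
        refine mem_Vsp_iff.2 ⟨fun i hi => ?_, fun x hx =>
          Set.indicator_of_notMem (fun hx' => hx (cell_subset_Ico hab hj hx')) _⟩
        by_cases hij : i = j
        · subst hij
          exact ⟨q, hq, fun x hx => Set.indicator_of_mem hx _⟩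
        · refine ⟨0, by simp, fun x hx => ?_⟩
          rw [Set.indicator_of_notMem, Polynomial.eval_zero]
          intro hx'
          exact hij ((floor_eq_of_mem_cell hab hx).symm.trans (floor_eq_of_mem_cell hab hx'))
      have := hf.2 _ hg
      rw [L2ip] at this
      rw [← this]
      nth_rewrite 1 [← Set.inter_eq_right.2 (cell_subset_Ico hab hj)]
      rw [← setIntegral_indicator (measurableSet_cell a b n j)]
      congr with x
      exact Set.indicator_mul_right (cell a b n j) f fun x => q.eval x
    | zero => exact ⟨zero_mem _, by simp⟩
    | add f g _ _ hf hg =>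
      refine ⟨add_mem hf.1 hg.1, ?_⟩
      simp_rw [Pi.add_apply, add_mul]
      rw [integral_add (integrableOn_mul_eval_coarse_cell hab hf.1 hj q)
        (integrableOn_mul_eval_coarse_cell hab hg.1 hj q), hf.2, hg.2, add_zero]
    | smul c f _ hf =>
      refine ⟨Submodule.smul_mem _ _ hf.1, ?_⟩
      simp_rw [Pi.smul_apply, smul_eq_mul, mul_assoc]
      rw [integral_const_mul, hf.2, mul_zero]
  exact key.2

theorem disjoint_Vsp_Wsp_succ {a b : ℝ} (hab : a < b) (n k : ℕ) :
    Disjoint (Vsp a b n k) (Wsp a b (n + 1) k) := by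
  rw [Submodule.disjoint_def]
  intro f hV hW
  obtain ⟨hf, hf'⟩ := mem_Vsp_iff.1 hV
  funext x
  by_cases hx : x ∈ Set.Ico a b
  swap
  · exact hf' x hx
  obtain ⟨j, hj, hxj⟩ := exists_mem_cell n hx
  obtain ⟨p, hp, hfp⟩ := hf j hj
  have h0 := integral_cell_eq_zero_of_mem_Wsp hab hW hj hp
  rw [setIntegral_congr_fun (g := fun x => p.eval x * p.eval x) (measurableSet_cell a b n j)
    (fun y hy => by simp only [hfp y hy])] at h0
  rw [hfp x hxj, Polynomial.eq_zero_of_integral_mul_self (left_lt_right_cell hab n j) h0]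
  simp

theorem Vsp_sup_Wsp_succ {a b : ℝ} (hab : a < b) (n k : ℕ) :
    Vsp a b n k ⊔ Wsp a b (n + 1) k = Vsp a b (n + 1) k := by
  refine le_antisymm (sup_le (Vsp_le_succ hab n k) (Wsp_le _ k)) fun f hf => ?_
  have hproj : ∀ j, ∃ p : Polynomial ℝ, j < 2 ^ n → p.natDegree ≤ k ∧
      ∀ q : Polynomial ℝ, q.natDegree ≤ k →
        ∫ x in cell a b n j, (f x - p.eval x) * q.eval x = 0 := by
    intro j
    by_cases hj : j < 2 ^ n
    · obtain ⟨p, hp⟩ := exists_polynomial_projection (left_lt_right_cell hab n j) k f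
        (integrableOn_mul_eval_coarse_cell hab hf hj)
      exact ⟨p, fun _ => hp⟩
    · exact ⟨0, fun h => absurd h hj⟩
  choose p hp using hproj
  have hP : gluePoly a b n p ∈ Vsp a b n k := gluePoly_mem_Vsp hab fun j hj => (hp j hj).1
  refine Submodule.mem_sup.2 ⟨_, hP, f - gluePoly a b n p, ?_, add_sub_cancel _ _⟩
  rw [Wsp, if_neg n.succ_ne_zero, Nat.add_sub_cancel]
  refine Submodule.subset_span ⟨sub_mem hf (Vsp_le_succ hab n k hP), fun g hg => ?_⟩
  refine setIntegral_Ico_eq_zero_of_cells hab n fun j hj => ?_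
  obtain ⟨q, hq, hgq⟩ := (mem_Vsp_iff.1 hg).1 j hj
  rw [← (hp j hj).2 q hq]
  refine setIntegral_congr_fun (measurableSet_cell a b n j) fun x hx => ?_
  simp only [Pi.sub_apply, gluePoly_apply hab hj p hx, hgq x hx]

theorem restr01_apply_of_mem {f : ℝ → ℝ} {x : ℝ} (hx : x ∈ Set.Ico (0 : ℝ) 1) :
    restr01 f x = f x :=
  Set.indicator_of_mem hx f

theorem restr01_apply_of_notMem {f : ℝ → ℝ} {x : ℝ} (hx : x ∉ Set.Ico (0 : ℝ) 1) :
    restr01 f x = 0 :=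
  Set.indicator_of_notMem hx f

theorem half_mesh_pos (N : ℕ) : (0 : ℝ) < 1 / 2 ^ (N + 1) := by positivity

theorem half_mesh_lt {N l : ℕ} (hl : l ≤ N) : (1 : ℝ) / 2 ^ (N + 1) < 1 / 2 ^ l :=
  one_div_lt_one_div_of_lt (by positivity) (pow_lt_pow_right₀ one_lt_two (by omega))

theorem half_mesh_lt_one (N : ℕ) : (1 : ℝ) / 2 ^ (N + 1) < 1 := by
  simpa using half_mesh_lt (Nat.zero_le N)

theorem shifted_left_lt_right (N : ℕ) : -(1 / 2 ^ (N + 1) : ℝ) < 1 - 1 / 2 ^ (N + 1) := by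
  linarith

theorem cell_shifted (N l j : ℕ) :
    cell (-(1 / 2 ^ (N + 1))) (1 - 1 / 2 ^ (N + 1)) l j =
      Set.Ico ((j : ℝ) / 2 ^ l - 1 / 2 ^ (N + 1)) (((j : ℝ) + 1) / 2 ^ l - 1 / 2 ^ (N + 1)) := by
  unfold cell
  congr 1 <;> ring

theorem dual_cell_eq {N l j : ℕ} (hl : l ≤ N) (hj : j < 2 ^ l) :
    Set.Ico (dualLeft N l j) (dualRight N l j) =
      cell (-(1 / 2 ^ (N + 1))) (1 - 1 / 2 ^ (N + 1)) l j ∩ Set.Ico 0 1 := by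
  have hδ := half_mesh_pos N
  have hle : ((j : ℝ) + 1) / 2 ^ l ≤ 1 := by
    rw [div_le_one (by positivity)]
    exact_mod_cast hj
  rw [cell_shifted, Set.Ico_inter_Ico, dualLeft, dualRight, if_neg hj.ne,
    min_eq_left (by linarith)]
  congr 1
  split_ifs with h0
  · rw [h0, max_eq_right]
    simp
  · rw [max_eq_left]
    have h1 : (1 : ℝ) / 2 ^ l ≤ j / 2 ^ l := by
      gcongr
      exact_mod_cast Nat.one_le_iff_ne_zero.2 h0
    linarith [half_mesh_lt hl]

theorem last_dual_cell_eq (N l : ℕ) :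
    Set.Ico (dualLeft N l (2 ^ l)) (dualRight N l (2 ^ l)) =
      Set.Ico (1 - 1 / 2 ^ (N + 1) : ℝ) 1 := by
  rw [dualLeft, dualRight, if_pos rfl, if_neg (by positivity)]
  push_cast
  rw [div_self (by positivity)]

theorem cell_zero_zero (a b : ℝ) : cell a b 0 0 = Set.Ico a b := by simp [cell]

theorem Vd_eq_map_sup {N l : ℕ} (k : ℕ) (hl : l ≤ N) :
    Vd N l k = (Vsp (-(1 / 2 ^ (N + 1))) (1 - 1 / 2 ^ (N + 1)) l k).map restr01 ⊔
      Vsp (1 - 1 / 2 ^ (N + 1)) 1 0 k := by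
  have hab := shifted_left_lt_right N
  have hδ := half_mesh_pos N
  have hb1 : (1 - 1 / 2 ^ (N + 1) : ℝ) < 1 := by linarith
  have hδ1 := half_mesh_lt_one N
  apply le_antisymm
  · intro f hf
    obtain ⟨hf, hf0⟩ := mem_Vd_iff.1 hf
    choose! p hp hfp using hf
    have hsub : ∀ x ∉ Set.Ico (0 : ℝ) 1, x ∉ Set.Ico (1 - 1 / 2 ^ (N + 1) : ℝ) 1 :=
      fun x hx hx' => hx ⟨by linarith [hx'.1], hx'.2⟩
    refine Submodule.mem_sup.2 ⟨_, Submodule.mem_map_of_mem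
      (gluePoly_mem_Vsp (p := p) hab fun j hj => hp j hj.le), _,
      gluePoly_mem_Vsp (p := fun _ => p (2 ^ l)) hb1 fun _ _ => hp _ le_rfl, ?_⟩
    funext x
    rw [Pi.add_apply]
    by_cases hx : x ∈ Set.Ico (0 : ℝ) 1
    · rw [restr01_apply_of_mem hx]
      by_cases hxb : x < 1 - 1 / 2 ^ (N + 1)
      · obtain ⟨j, hj, hxj⟩ := exists_mem_cell (a := -(1 / 2 ^ (N + 1))) l
          ⟨by linarith [hx.1], hxb⟩
        rw [gluePoly_apply hab hj p hxj, hfp j hj.le x (by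
          rw [dual_cell_eq hl hj]; exact ⟨hxj, hx⟩), gluePoly, Set.indicator_of_notMem, add_zero]
        exact fun h => not_lt.2 h.1 hxb
      · have hxt : x ∈ Set.Ico (1 - 1 / 2 ^ (N + 1) : ℝ) 1 := ⟨not_lt.1 hxb, hx.2⟩
        rw [gluePoly_apply hb1 (j := 0) (by simp) _ (by rwa [cell_zero_zero]),
          hfp _ le_rfl x (by rwa [last_dual_cell_eq]), gluePoly, Set.indicator_of_notMem, zero_add]
        exact fun h => hxb h.2
    · rw [restr01_apply_of_notMem hx, hf0 x hx, gluePoly, Set.indicator_of_notMem (hsub x hx),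
        add_zero]
  · refine sup_le (Submodule.map_le_iff_le_comap.2 fun g hg => mem_Vd_iff.2
      ⟨fun j hj => ?_, fun x hx => restr01_apply_of_notMem hx⟩) fun t ht => mem_Vd_iff.2
      ⟨fun j hj => ?_, fun x hx => ?_⟩
    · obtain ⟨hg, hg0⟩ := mem_Vsp_iff.1 hg
      rcases hj.lt_or_eq with hj | rfl
      · obtain ⟨p, hp, hgp⟩ := hg j hj
        refine ⟨p, hp, fun x hx => ?_⟩
        rw [dual_cell_eq hl hj] at hx
        rw [restr01_apply_of_mem hx.2]
        exact hgp x hx.1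
      · refine ⟨0, by simp, fun x hx => ?_⟩
        rw [last_dual_cell_eq] at hx
        rw [restr01_apply_of_mem ⟨by linarith [hx.1], hx.2⟩, hg0 x fun h => not_lt.2 hx.1 h.2,
          Polynomial.eval_zero]
    · obtain ⟨ht, ht0⟩ := mem_Vsp_iff.1 ht
      rcases hj.lt_or_eq with hj | rfl
      · refine ⟨0, by simp, fun x hx => ?_⟩
        rw [dual_cell_eq hl hj] at hx
        rw [ht0 x fun h => not_lt.2 h.1 (cell_subset_Ico hab hj hx.1).2, Polynomial.eval_zero]
      · obtain ⟨p, hp, htp⟩ := ht 0 (by simp)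
        refine ⟨p, hp, fun x hx => htp x ?_⟩
        rw [last_dual_cell_eq, ← cell_zero_zero] at hx
        exact hx
    · exact (mem_Vsp_iff.1 ht).2 x fun h => hx ⟨by linarith [h.1], h.2⟩

theorem eq_zero_of_restr01_eq_zero {N l k : ℕ} (hl : l ≤ N) {g : ℝ → ℝ}
    (hg : g ∈ Vsp (-(1 / 2 ^ (N + 1))) (1 - 1 / 2 ^ (N + 1)) l k)
    (h : ∀ x ∈ Set.Ico (0 : ℝ) (1 - 1 / 2 ^ (N + 1)), g x = 0) : g = 0 := by
  obtain ⟨hg, hg0⟩ := mem_Vsp_iff.1 hg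
  obtain ⟨p, -, hgp⟩ := hg 0 (by positivity)
  change ∀ x ∈ cell _ _ l 0, _ at hgp
  rw [cell_shifted] at hgp
  simp only [Nat.cast_zero, zero_div, zero_sub, zero_add] at hgp
  have hlt := half_mesh_lt hl
  have hδ := half_mesh_pos N
  have hl1 : (1 : ℝ) / 2 ^ l ≤ 1 := (div_le_one (by positivity)).2 (one_le_pow₀ one_le_two)
  have hp : p = 0 := Polynomial.eq_zero_of_eval_Ico (sub_pos.2 hlt) fun x hx => by
    rw [← hgp x ⟨by linarith [hx.1], hx.2⟩]
    exact h x ⟨hx.1, by linarith [hx.2]⟩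
  funext x
  by_cases hx : x ∈ Set.Ico (-(1 / 2 ^ (N + 1)) : ℝ) (1 - 1 / 2 ^ (N + 1))
  · by_cases hx0 : 0 ≤ x
    · exact h x ⟨hx0, hx.2⟩
    · rw [hgp x ⟨hx.1, by linarith⟩, hp]
      simp
  · exact hg0 x hx

theorem Wd_succ (N l k : ℕ) : Wd N (l + 1) k =
    (Wsp (-(1 / 2 ^ (N + 1))) (1 - 1 / 2 ^ (N + 1)) (l + 1) k).map restr01 :=
  if_neg l.succ_ne_zero

theorem Vd_sup_Wd_succ {N l : ℕ} (k : ℕ) (hl : l + 1 ≤ N) :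
    Vd N l k ⊔ Wd N (l + 1) k = Vd N (l + 1) k := by
  rw [Vd_eq_map_sup k hl, Vd_eq_map_sup k (Nat.le_of_succ_le hl), Wd_succ, sup_right_comm,
    ← Submodule.map_sup, Vsp_sup_Wsp_succ (shifted_left_lt_right N)]

theorem disjoint_Vd_Wd_succ {N l : ℕ} (k : ℕ) (hl : l + 1 ≤ N) :
    Disjoint (Vd N l k) (Wd N (l + 1) k) := by
  have hab := shifted_left_lt_right N
  rw [Vd_eq_map_sup k (Nat.le_of_succ_le hl), Wd_succ, Submodule.disjoint_def]
  rintro f hV ⟨w, hw, rfl⟩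
  obtain ⟨_, ⟨v, hv, rfl⟩, t, ht, heq⟩ := Submodule.mem_sup.1 hV
  have hvw : v - w = 0 := eq_zero_of_restr01_eq_zero hl
    (sub_mem (Vsp_le_succ hab l k hv) (Wsp_le _ k hw)) fun x hx => by
      have hx1 : x ∈ Set.Ico (0 : ℝ) 1 := ⟨hx.1, by linarith [hx.2, half_mesh_pos N]⟩
      have hx' := congrFun heq x
      rw [Pi.add_apply, (mem_Vsp_iff.1 ht).2 x fun h => not_lt.2 h.1 hx.2,
        restr01_apply_of_mem hx1, restr01_apply_of_mem hx1] at hx'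
      rw [Pi.sub_apply]
      linarith
  rw [sub_eq_zero] at hvw
  subst hvw
  rw [Submodule.disjoint_def.1 (disjoint_Vsp_Wsp_succ hab l k) v hv hw, map_zero]

theorem supIndep_range_and_sup_eq {α : Type*} [CompleteLattice α] [IsModularLattice α]
    {V W : ℕ → α} {N : ℕ} (h0 : V 0 = W 0)
    (hdisj : ∀ l < N, Disjoint (V l) (W (l + 1))) (hsup : ∀ l < N, V l ⊔ W (l + 1) = V (l + 1)) :
    ∀ n ≤ N, (Finset.range (n + 1)).SupIndep W ∧ (Finset.range (n + 1)).sup W = V n := by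
  intro n hn
  induction n with
  | zero => simp [h0]
  | succ n ih =>
    obtain ⟨hi, hs⟩ := ih (by omega)
    rw [Finset.range_add_one]
    refine ⟨hi.insert ?_, ?_⟩
    · rw [hs]
      exact (hdisj n hn).symm
    · rw [Finset.sup_insert, hs, sup_comm, hsup n hn]

/-- for `1 ≤ l ≤ N` one has the (not necessarily orthogonal) direct sum
`V^k_{l,N,D} = V^k_{l-1,N,D} ⊕ W^k_{l,N,D}`; consequently
`V^k_{N,D} = V^k_{N,N,D} = ⊕_{l=0}^{N} W^k_{l,N,D}`. -/
theorem dual_direct_sum_decomposition (N k : ℕ) (hN : 1 ≤ N) :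
    (∀ l : ℕ, 1 ≤ l → l ≤ N →
      Vd N (l - 1) k ⊓ Wd N l k = ⊥ ∧ Vd N (l - 1) k ⊔ Wd N l k = Vd N l k) ∧
    iSupIndep (fun l : Fin (N + 1) => Wd N (l : ℕ) k) ∧
    Vd N N k = ⨆ l : Fin (N + 1), Wd N (l : ℕ) k := by
  have hmain := supIndep_range_and_sup_eq (V := fun l => Vd N l k) (W := fun l => Wd N l k)
    (if_pos rfl : Wd N 0 k = Vd N 0 k).symm (fun l hl => disjoint_Vd_Wd_succ k hl)
    (fun l hl => Vd_sup_Wd_succ k hl) N le_rfl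
  have hrange : Finset.range (N + 1) = Finset.univ.map (Fin.valEmbedding (n := N + 1)) := by
    ext j
    simp
  rw [hrange, Finset.supIndep_map, Finset.sup_map, Finset.sup_univ_eq_iSup] at hmain
  refine ⟨fun l hl1 hl => ?_, iSupIndep_iff_supIndep_univ.2 hmain.1, hmain.2.symm⟩
  obtain ⟨m, rfl⟩ := Nat.exists_eq_add_of_le' hl1
  exact ⟨(disjoint_Vd_Wd_succ k hl).eq_bot, Vd_sup_Wd_succ k hl⟩
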